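/- arXiv:2412.17658 — 2 statements merged into one kernel-verified Lean document; each statement's English description precedes it below -/
import Mathlib

section
/- Let S, Z, W be random variables on finite alphabets with joint distribution P_{S,Z,W}, where Z plays the role of the semantic f(X) and W the role of the task h(X), and let ε satisfy 0 ≤ ε ≤ H(S). Then there exists a random variable U, jointly distributed with (S,Z,W) and generated from (S,Z), such that I(U;S) = ε and I(U;W) ≥ L^1(ε) := H(Z|S) − H(S|Z) + ε − H(Z|W). (First lower bound on utility in Theorem 1.) -/
open MeasureTheory ProbabilityTheory

/-- Shannon entropy (natural logarithm) of a random variable `X`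
taking values in a finite alphabet `α`. -/
noncomputable def infH {Ω : Type*} [MeasurableSpace Ω] {α : Type*} [Fintype α]
    (P : Measure Ω) (X : Ω → α) : ℝ :=
  ∑ a : α, Real.negMulLog (P (X ⁻¹' {a})).toReal

/-- Conditional Shannon entropy `H(X | Y)`. -/
noncomputable def infCondH {Ω : Type*} [MeasurableSpace Ω] {α β : Type*} [Fintype α] [Fintype β]
    (P : Measure Ω) (X : Ω → α) (Y : Ω → β) : ℝ :=
  infH P (fun ω => (X ω, Y ω)) - infH P Y

/-- Mutual information `I(X ; Y)`. -/
noncomputable def infMI {Ω : Type*} [MeasurableSpace Ω] {α β : Type*} [Fintype α] [Fintype β]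
    (P : Measure Ω) (X : Ω → α) (Y : Ω → β) : ℝ :=
  infH P X + infH P Y - infH P (fun ω => (X ω, Y ω))

/-- Conditional mutual information `I(X ; Y | Z)`. -/
noncomputable def infCMI {Ω : Type*} [MeasurableSpace Ω] {α β γ : Type*}
    [Fintype α] [Fintype β] [Fintype γ]
    (P : Measure Ω) (X : Ω → α) (Y : Ω → β) (Z : Ω → γ) : ℝ :=
  infCondH P X Z + infCondH P Y Z - infCondH P (fun ω => (X ω, Y ω)) Z

open Classical in
theorem measureReal_preimage_eq_sum {Ω α : Type*} [MeasurableSpace Ω] [Fintype Ω]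
    [MeasurableSingletonClass Ω] (P : Measure Ω) [IsFiniteMeasure P] (X : Ω → α) (a : α) :
    (P (X ⁻¹' {a})).toReal = ∑ ω, if X ω = a then P.real {ω} else 0 := by
  rw [← Finset.sum_filter, sum_measureReal_singleton, Measure.real]
  congr 2
  ext ω
  simp

open Classical in
theorem measureReal_preimage_comp {Ω α β : Type*} [MeasurableSpace Ω] [Fintype Ω]
    [MeasurableSingletonClass Ω] [Fintype α] (P : Measure Ω) [IsFiniteMeasure P]
    (X : Ω → α) (f : α → β) (b : β) :
    (P ((fun ω => f (X ω)) ⁻¹' {b})).toReal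
      = ∑ a, if f a = b then (P (X ⁻¹' {a})).toReal else 0 := by
  simp only [measureReal_preimage_eq_sum]
  have h (a : α) : (if f a = b then ∑ ω, (if X ω = a then P.real {ω} else 0) else 0)
      = ∑ ω, if X ω = a then (if f a = b then P.real {ω} else 0) else 0 := by
    split_ifs <;> simp
  simp only [h]
  rw [Finset.sum_comm]
  simp

theorem negMulLog_sum_le {ι : Type*} (s : Finset ι) (p : ι → ℝ) (hp : ∀ i ∈ s, 0 ≤ p i) :
    Real.negMulLog (∑ i ∈ s, p i) ≤ ∑ i ∈ s, Real.negMulLog (p i) := by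
  simp only [Real.negMulLog, neg_mul, Finset.sum_neg_distrib, neg_le_neg_iff, Finset.sum_mul]
  refine Finset.sum_le_sum fun i hi => ?_
  rcases (hp i hi).eq_or_lt with h | h
  · simp [← h]
  · exact mul_le_mul_of_nonneg_left
      (Real.log_le_log h (Finset.single_le_sum hp hi)) h.le

theorem infH_comp_le {Ω α β : Type*} [MeasurableSpace Ω] [Fintype Ω]
    [MeasurableSingletonClass Ω] [Fintype α] [Fintype β] (P : Measure Ω) [IsFiniteMeasure P]
    (X : Ω → α) (f : α → β) :
    infH P (fun ω => f (X ω)) ≤ infH P X := by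
  classical
  unfold infH
  calc ∑ b, Real.negMulLog (P ((fun ω => f (X ω)) ⁻¹' {b})).toReal
      ≤ ∑ b, ∑ a with f a = b, Real.negMulLog (P (X ⁻¹' {a})).toReal := by
        refine Finset.sum_le_sum fun b _ => ?_
        rw [measureReal_preimage_comp, ← Finset.sum_filter]
        convert negMulLog_sum_le _ _ fun a _ => ENNReal.toReal_nonneg
    _ = _ := Finset.sum_fiberwise _ _ _

theorem infH_comp_equiv {Ω α β : Type*} [MeasurableSpace Ω] [Fintype Ω]
    [MeasurableSingletonClass Ω] [Fintype α] [Fintype β] (P : Measure Ω) [IsFiniteMeasure P]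
    (X : Ω → α) (e : α ≃ β) :
    infH P (fun ω => e (X ω)) = infH P X := by
  refine le_antisymm (infH_comp_le P X e) ?_
  simpa using infH_comp_le P (fun ω => e (X ω)) e.symm

theorem sum_measureReal_preimage_prodMk {Ω α β : Type*} [MeasurableSpace Ω] [Fintype Ω]
    [MeasurableSingletonClass Ω] [Fintype α] [Fintype β] (P : Measure Ω) [IsFiniteMeasure P]
    (X : Ω → α) (Y : Ω → β) (a : α) :
    ∑ b, (P ((fun ω => (X ω, Y ω)) ⁻¹' {(a, b)})).toReal = (P (X ⁻¹' {a})).toReal := by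
  classical
  have h := measureReal_preimage_comp P (fun ω => (X ω, Y ω)) Prod.fst a
  simp only [Fintype.sum_prod_type] at h
  rw [h, Finset.sum_comm]
  simp

/-- Strong subadditivity for a nonnegative array, written with negated entropies. -/
theorem sum_negMulLog_submodular {α β γ : Type*} [Fintype α] [Fintype β] [Fintype γ]
    (p : α → β → γ → ℝ) (hp : ∀ x y z, 0 ≤ p x y z) :
    ∑ z, Real.negMulLog (∑ x, ∑ y, p x y z) + ∑ x, ∑ y, ∑ z, Real.negMulLog (p x y z)
      ≤ ∑ x, ∑ z, Real.negMulLog (∑ y, p x y z) + ∑ y, ∑ z, Real.negMulLog (∑ x, p x y z) := by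
  set a : α → γ → ℝ := fun x z => ∑ y, p x y z with ha
  set b : β → γ → ℝ := fun y z => ∑ x, p x y z with hb
  set c : γ → ℝ := fun z => ∑ x, ∑ y, p x y z with hc
  have hac (z) : ∑ x, a x z = c z := rfl
  have hbc (z) : ∑ y, b y z = c z := Finset.sum_comm
  have ha0 (x z) : 0 ≤ a x z := Finset.sum_nonneg fun y _ => hp x y z
  have hb0 (y z) : 0 ≤ b y z := Finset.sum_nonneg fun x _ => hp x y z
  have hc0 (z) : 0 ≤ c z := Finset.sum_nonneg fun x _ => ha0 x z
  have hpa (x y z) : p x y z ≤ a x z :=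
    Finset.single_le_sum (f := fun y => p x y z) (fun y _ => hp x y z) (Finset.mem_univ y)
  have hpb (x y z) : p x y z ≤ b y z :=
    Finset.single_le_sum (f := fun x => p x y z) (fun x _ => hp x y z) (Finset.mem_univ x)
  have hac' (x z) : a x z ≤ c z :=
    Finset.single_le_sum (f := fun x => a x z) (fun x _ => ha0 x z) (Finset.mem_univ x)
  have key (x y z) : p x y z * (Real.log (a x z) + Real.log (b y z) - Real.log (c z)
      - Real.log (p x y z)) ≤ a x z * b y z / c z - p x y z := by
    rcases (hp x y z).eq_or_lt with h | h
    · rw [← h]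
      have := div_nonneg (mul_nonneg (ha0 x z) (hb0 y z)) (hc0 z)
      simpa using this
    · have h1 := h.trans_le (hpa x y z)
      have h2 := h.trans_le (hpb x y z)
      have h3 := h1.trans_le (hac' x z)
      have hl : Real.log (a x z) + Real.log (b y z) - Real.log (c z) - Real.log (p x y z)
          = Real.log (a x z * b y z / c z / p x y z) := by
        rw [Real.log_div (by positivity) h.ne', Real.log_div (by positivity) h3.ne',
          Real.log_mul h1.ne' h2.ne']
      rw [hl]
      calc _ ≤ p x y z * (a x z * b y z / c z / p x y z - 1) :=
            mul_le_mul_of_nonneg_left (Real.log_le_sub_one_of_pos (by positivity)) h.le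
        _ = _ := by field_simp
  have hsum : ∑ z, ∑ x, ∑ y, (a x z * b y z / c z - p x y z) ≤ 0 := by
    refine Finset.sum_nonpos fun z _ => ?_
    simp only [Finset.sum_sub_distrib, ← Finset.sum_div, ← Finset.mul_sum, ← Finset.sum_mul,
      hbc, hac]
    change c z * c z / c z - c z ≤ 0
    rw [mul_self_div_self, sub_self]
  have hle := (Finset.sum_le_sum fun z (_ : z ∈ Finset.univ) =>
    Finset.sum_le_sum fun x (_ : x ∈ Finset.univ) =>
      Finset.sum_le_sum fun y (_ : y ∈ Finset.univ) => key x y z).trans hsum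
  have e1 : ∑ z, Real.negMulLog (c z) = -∑ z, ∑ x, ∑ y, p x y z * Real.log (c z) := by
    simp only [← Finset.sum_mul, Real.negMulLog, neg_mul, Finset.sum_neg_distrib, hc]
  have e2 : ∑ x, ∑ z, Real.negMulLog (a x z)
      = -∑ z, ∑ x, ∑ y, p x y z * Real.log (a x z) := by
    rw [Finset.sum_comm]
    simp only [← Finset.sum_mul, Real.negMulLog, neg_mul, Finset.sum_neg_distrib, ha]
  have e3 : ∑ y, ∑ z, Real.negMulLog (b y z)
      = -∑ z, ∑ x, ∑ y, p x y z * Real.log (b y z) := by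
    rw [Finset.sum_comm, ← Finset.sum_neg_distrib]
    refine Finset.sum_congr rfl fun z _ => ?_
    rw [Finset.sum_comm]
    simp only [← Finset.sum_mul, Real.negMulLog, neg_mul, Finset.sum_neg_distrib, hb]
  have e4 : ∑ x, ∑ y, ∑ z, Real.negMulLog (p x y z)
      = -∑ z, ∑ x, ∑ y, p x y z * Real.log (p x y z) := by
    simp only [Real.negMulLog, neg_mul, Finset.sum_neg_distrib]
    rw [Finset.sum_congr rfl fun x _ => Finset.sum_comm, Finset.sum_comm]
  simp only [mul_sub, mul_add, Finset.sum_sub_distrib, Finset.sum_add_distrib] at hle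
  change ∑ z, Real.negMulLog (c z) + _ ≤ ∑ x, ∑ z, Real.negMulLog (a x z)
    + ∑ y, ∑ z, Real.negMulLog (b y z)
  rw [e1, e2, e3, e4]
  linarith

theorem sum_measureReal_preimage_left {Ω α β : Type*} [MeasurableSpace Ω] [Fintype Ω]
    [MeasurableSingletonClass Ω] [Fintype α] [Fintype β] (P : Measure Ω) [IsFiniteMeasure P]
    (X : Ω → α) (Y : Ω → β) (b : β) :
    ∑ a, (P ((fun ω => (X ω, Y ω)) ⁻¹' {(a, b)})).toReal = (P (Y ⁻¹' {b})).toReal := by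
  rw [← sum_measureReal_preimage_prodMk P Y X b]
  refine Finset.sum_congr rfl fun a _ => ?_
  congr 2
  ext ω
  simp [and_comm]

theorem sum_measureReal_preimage_middle {Ω α β γ : Type*} [MeasurableSpace Ω] [Fintype Ω]
    [MeasurableSingletonClass Ω] [Fintype α] [Fintype β] [Fintype γ] (P : Measure Ω)
    [IsFiniteMeasure P] (X : Ω → α) (Y : Ω → β) (Z : Ω → γ) (x : α) (z : γ) :
    ∑ y, (P ((fun ω => ((X ω, Y ω), Z ω)) ⁻¹' {((x, y), z)})).toReal
      = (P ((fun ω => (X ω, Z ω)) ⁻¹' {(x, z)})).toReal := by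
  rw [← sum_measureReal_preimage_prodMk P (fun ω => (X ω, Z ω)) Y]
  refine Finset.sum_congr rfl fun y _ => ?_
  congr 2
  ext ω
  simp only [Set.mem_preimage, Set.mem_singleton_iff, Prod.mk.injEq]
  tauto

theorem sum_measureReal_preimage_first {Ω α β γ : Type*} [MeasurableSpace Ω] [Fintype Ω]
    [MeasurableSingletonClass Ω] [Fintype α] [Fintype β] [Fintype γ] (P : Measure Ω)
    [IsFiniteMeasure P] (X : Ω → α) (Y : Ω → β) (Z : Ω → γ) (y : β) (z : γ) :
    ∑ x, (P ((fun ω => ((X ω, Y ω), Z ω)) ⁻¹' {((x, y), z)})).toReal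
      = (P ((fun ω => (Y ω, Z ω)) ⁻¹' {(y, z)})).toReal := by
  rw [← sum_measureReal_preimage_left P X (fun ω => (Y ω, Z ω))]
  refine Finset.sum_congr rfl fun x _ => ?_
  congr 2
  ext ω
  simp only [Set.mem_preimage, Set.mem_singleton_iff, Prod.mk.injEq]
  tauto

theorem infCMI_nonneg {Ω α β γ : Type*} [MeasurableSpace Ω] [Fintype Ω]
    [MeasurableSingletonClass Ω] [Fintype α] [Fintype β] [Fintype γ] (P : Measure Ω)
    [IsFiniteMeasure P] (X : Ω → α) (Y : Ω → β) (Z : Ω → γ) :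
    0 ≤ infCMI P X Y Z := by
  have h := sum_negMulLog_submodular
    (fun x y z => (P ((fun ω => ((X ω, Y ω), Z ω)) ⁻¹' {((x, y), z)})).toReal)
    fun _ _ _ => ENNReal.toReal_nonneg
  simp only [sum_measureReal_preimage_middle, sum_measureReal_preimage_first,
    sum_measureReal_preimage_left] at h
  simp only [infCMI, infCondH, infH, Fintype.sum_prod_type]
  linarith

theorem infCMI_eq_zero_of_factor {Ω α β γ : Type*} [MeasurableSpace Ω] [Fintype Ω]
    [MeasurableSingletonClass Ω] [Fintype α] [Fintype β] [Fintype γ] (P : Measure Ω)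
    [IsFiniteMeasure P] (X : Ω → α) (Y : Ω → β) (Z : Ω → γ) (A : α → γ → ℝ) (k : γ → β → ℝ)
    (hk : ∀ z, ∑ y, k z y = 1)
    (h : ∀ x y z, (P ((fun ω => ((X ω, Y ω), Z ω)) ⁻¹' {((x, y), z)})).toReal
      = A x z * k z y) :
    infCMI P X Y Z = 0 := by
  have hXZ (x z) : (P ((fun ω => (X ω, Z ω)) ⁻¹' {(x, z)})).toReal = A x z := by
    simp_rw [← sum_measureReal_preimage_middle P X Y Z, h, ← Finset.mul_sum, hk, mul_one]
  have hYZ (y z) : (P ((fun ω => (Y ω, Z ω)) ⁻¹' {(y, z)})).toReal = (∑ x, A x z) * k z y := by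
    simp_rw [← sum_measureReal_preimage_first P X Y Z, h, ← Finset.sum_mul]
  have hZ (z) : (P (Z ⁻¹' {z})).toReal = ∑ x, A x z := by
    simp_rw [← sum_measureReal_preimage_left P X Z, hXZ]
  have e1 : ∑ x, ∑ y, ∑ z, Real.negMulLog (A x z * k z y)
      = ∑ x, ∑ z, Real.negMulLog (A x z)
        + ∑ z, (∑ x, A x z) * ∑ y, Real.negMulLog (k z y) := by
    have hx (x : α) : ∑ y, ∑ z, Real.negMulLog (A x z * k z y) = ∑ z, Real.negMulLog (A x z)
        + ∑ z, A x z * ∑ y, Real.negMulLog (k z y) := by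
      rw [Finset.sum_comm, ← Finset.sum_add_distrib]
      simp only [Real.negMulLog_mul, Finset.sum_add_distrib, ← Finset.sum_mul, ← Finset.mul_sum,
        hk, one_mul]
    simp only [hx, Finset.sum_add_distrib, Finset.sum_mul]
    congr 1
    exact Finset.sum_comm
  have e2 : ∑ y, ∑ z, Real.negMulLog ((∑ x, A x z) * k z y)
      = ∑ z, Real.negMulLog (∑ x, A x z)
        + ∑ z, (∑ x, A x z) * ∑ y, Real.negMulLog (k z y) := by
    rw [Finset.sum_comm]
    simp only [Real.negMulLog_mul, Finset.sum_add_distrib, ← Finset.sum_mul, ← Finset.mul_sum,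
      hk, one_mul]
  simp only [infCMI, infCondH, infH, Fintype.sum_prod_type, h, hXZ, hYZ, hZ, e1, e2]
  ring

theorem exists_conditional {α β : Type*} [Fintype β] [Nonempty β]
    (q : α → β → ℝ) (hq : ∀ a b, 0 ≤ q a b) :
    ∃ c : α → β → ℝ, (∀ a b, 0 ≤ c a b) ∧ (∀ a, ∑ b, c a b = 1) ∧
      ∀ a b, q a b = (∑ b', q a b') * c a b := by
  have h (a : α) : ∃ c : β → ℝ, (∀ b, 0 ≤ c b) ∧ ∑ b, c b = 1 ∧
      ∀ b, q a b = (∑ b', q a b') * c b := by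
    classical
    by_cases h0 : ∑ b', q a b' = 0
    · obtain ⟨b₀⟩ := ‹Nonempty β›
      refine ⟨Pi.single b₀ 1, fun b => ?_, by simp, fun b => ?_⟩
      · by_cases hb : b = b₀
        · subst hb; simp
        · simp [hb]
      · rw [h0, zero_mul]
        exact (Finset.sum_eq_zero_iff_of_nonneg fun b _ => hq a b).1 h0 b (Finset.mem_univ b)
    · refine ⟨fun b => q a b / ∑ b', q a b', fun b =>
        div_nonneg (hq a b) (Finset.sum_nonneg fun b _ => hq a b), ?_, fun b => ?_⟩
      · rw [← Finset.sum_div, div_self h0]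
      · field_simp
  choose c hc using h
  exact ⟨c, fun a => (hc a).1, fun a => (hc a).2.1, fun a => (hc a).2.2⟩

/-- A product of probability vectors has the prescribed marginals. -/
theorem sum_prod_marginal {σ ζ : Type*} [Fintype σ] [DecidableEq σ] [Fintype ζ] [DecidableEq ζ]
    (c : σ → ζ → ℝ) (hc : ∀ s, ∑ z, c s z = 1) (s : σ) (z : ζ) :
    ∑ v : σ → ζ, (if v s = z then ∏ t, c t (v t) else 0) = c s z := by
  have h := Finset.prod_univ_sum (fun _ : σ => (Finset.univ : Finset ζ))
    fun t y => if t = s then (if y = z then c t y else 0) else c t y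
  rw [Fintype.piFinset_univ] at h
  calc _ = ∑ v : σ → ζ, ∏ t, (if t = s then (if v t = z then c t (v t) else 0)
          else c t (v t)) := by
        refine Finset.sum_congr rfl fun v _ => ?_
        split_ifs with hv
        · refine Finset.prod_congr rfl fun t _ => ?_
          split_ifs with h1 h2
          · rfl
          · exact absurd (h1 ▸ hv) h2
          · rfl
        · exact (Finset.prod_eq_zero (Finset.mem_univ s) (by simp [hv])).symm
    _ = _ := by
        rw [← h, Finset.prod_eq_single s]
        · simp
        · intro t _ ht
          simp [ht, hc]
        · simp

theorem exists_measure_of_weights {Ω : Type*} [MeasurableSpace Ω] [Fintype Ω]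
    [MeasurableSingletonClass Ω] (p : Ω → ℝ) (hp : ∀ ω, 0 ≤ p ω) (hsum : ∑ ω, p ω = 1) :
    ∃ P : Measure Ω, IsProbabilityMeasure P ∧ ∀ ω, P.real {ω} = p ω := by
  have h : ∑ ω, ENNReal.ofReal (p ω) = 1 := by
    rw [← ENNReal.ofReal_sum_of_nonneg fun ω _ => hp ω, hsum, ENNReal.ofReal_one]
  refine ⟨(PMF.ofFintype _ h).toMeasure, inferInstance, fun ω => ?_⟩
  rw [Measure.real, PMF.toMeasure_apply_singleton _ _ (MeasurableSet.singleton ω)]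
  simp [hp ω]

theorem infH_map {Ω Ω' α : Type*} [MeasurableSpace Ω] [MeasurableSpace Ω'] [Fintype Ω']
    [MeasurableSingletonClass Ω'] [Fintype α] (P : Measure Ω) {T : Ω → Ω'} (hT : Measurable T)
    (X : Ω' → α) : infH (P.map T) X = infH P (fun ω => X (T ω)) := by
  unfold infH
  refine Finset.sum_congr rfl fun a _ => ?_
  rw [Measure.map_apply hT (Set.toFinite _).measurableSet]
  rfl

theorem infH_of_product {Ω α β : Type*} [MeasurableSpace Ω] [Fintype α] [Fintype β]
    (P : Measure Ω) (X : Ω → α × β) (Q : α → ℝ) (r : β → ℝ) (hQ : ∑ a, Q a = 1)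
    (hr : ∑ b, r b = 1) (h : ∀ a b, (P (X ⁻¹' {(a, b)})).toReal = Q a * r b) :
    infH P X = ∑ a, Real.negMulLog (Q a) + ∑ b, Real.negMulLog (r b) := by
  simp only [infH, Fintype.sum_prod_type, h, Real.negMulLog_mul, Finset.sum_add_distrib,
    ← Finset.sum_mul, ← Finset.mul_sum, hQ, hr, one_mul]

/-- If the observation `X` determines `Z` once `S` is known, the utility of `X` about `W` is
bounded below in terms of its leakage about `S`. -/
theorem infMI_lower_bound {Ω α σ ζ τ : Type*} [MeasurableSpace Ω] [Fintype Ω]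
    [MeasurableSingletonClass Ω] [Fintype α] [Fintype σ] [Fintype ζ] [Fintype τ]
    (P : Measure Ω) [IsFiniteMeasure P] (X : Ω → α) (S : Ω → σ) (Z : Ω → ζ) (W : Ω → τ)
    (f : α → σ → ζ) (hf : ∀ ω, Z ω = f (X ω) (S ω)) :
    infCondH P Z S - infCondH P S Z + infMI P X S - infCondH P Z W ≤ infMI P X W := by
  have h1 : infH P (fun ω => (X ω, Z ω)) ≤ infH P (fun ω => (X ω, S ω)) := by
    simpa only [hf] using infH_comp_le P (fun ω => (X ω, S ω)) fun q => (q.1, f q.1 q.2)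
  have h2 := infCMI_nonneg P X W Z
  have h3 := infH_comp_le P (fun ω => ((X ω, W ω), Z ω)) Prod.fst
  have h4 := infH_comp_equiv P (fun ω => (Z ω, W ω)) (Equiv.prodComm _ _)
  have h5 := infH_comp_equiv P (fun ω => (S ω, Z ω)) (Equiv.prodComm _ _)
  simp only [Equiv.prodComm_apply, Prod.swap_prod_mk] at h3 h4 h5
  simp only [infCMI, infCondH, infMI] at h2 ⊢
  linarith

theorem infMI_comp_equiv {Ω α β γ : Type*} [MeasurableSpace Ω] [Fintype Ω]
    [MeasurableSingletonClass Ω] [Fintype α] [Fintype β] [Fintype γ] (P : Measure Ω)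
    [IsFiniteMeasure P] (X : Ω → α) (Y : Ω → γ) (e : α ≃ β) :
    infMI P (fun ω => e (X ω)) Y = infMI P X Y := by
  have h := infH_comp_equiv P (fun ω => (X ω, Y ω)) (e.prodCongr (Equiv.refl γ))
  simp only [Equiv.prodCongr_apply, Prod.map_apply, Equiv.refl_apply] at h
  rw [infMI, infMI, infH_comp_equiv, h]

theorem infCMI_comp_equiv {Ω α β γ δ : Type*} [MeasurableSpace Ω] [Fintype Ω]
    [MeasurableSingletonClass Ω] [Fintype α] [Fintype β] [Fintype γ] [Fintype δ] (P : Measure Ω)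
    [IsFiniteMeasure P] (X : Ω → α) (Y : Ω → γ) (Z : Ω → δ) (e : α ≃ β) :
    infCMI P (fun ω => e (X ω)) Y Z = infCMI P X Y Z := by
  have h := infH_comp_equiv P (fun ω => (X ω, Z ω)) (e.prodCongr (Equiv.refl δ))
  have h' := infH_comp_equiv P (fun ω => ((X ω, Y ω), Z ω))
    ((e.prodCongr (Equiv.refl γ)).prodCongr (Equiv.refl δ))
  simp only [Equiv.prodCongr_apply, Prod.map_apply, Equiv.refl_apply] at h h'
  rw [infCMI, infCMI, infCondH, infCondH, infCondH, infCondH, infCondH, h, h']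

/-- An erasure channel attains every leakage level between `0` and the entropy of the input. -/
theorem exists_erasure {σ : Type*} [Fintype σ] (p : σ → ℝ) (hp : ∀ s, 0 ≤ p s)
    (hsum : ∑ s, p s = 1) {ε : ℝ} (hε : 0 ≤ ε) (hεH : ε ≤ ∑ s, Real.negMulLog (p s)) :
    ∃ m : Option σ → σ → ℝ, (∀ j s, 0 ≤ m j s) ∧ (∀ s, ∑ j, m j s = p s) ∧
      ∑ j, Real.negMulLog (∑ s, m j s) + ∑ s, Real.negMulLog (p s)
        - ∑ j, ∑ s, Real.negMulLog (m j s) = ε := by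
  classical
  set h := ∑ s, Real.negMulLog (p s) with hh
  obtain ⟨a, ha0, ha1, hah⟩ : ∃ a : ℝ, 0 ≤ a ∧ a ≤ 1 ∧ a * h = ε := by
    rcases (hε.trans hεH).eq_or_lt with h0 | h0
    · exact ⟨0, le_rfl, zero_le_one, by linarith⟩
    · exact ⟨ε / h, div_nonneg hε h0.le, (div_le_one h0).2 hεH, div_mul_cancel₀ _ h0.ne'⟩
  have hscale (t : ℝ) : ∑ s, Real.negMulLog (t * p s) = Real.negMulLog t + t * h := by
    simp only [Real.negMulLog_mul, Finset.sum_add_distrib, ← Finset.sum_mul, ← Finset.mul_sum,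
      hsum, one_mul, hh]
  refine ⟨fun j s => j.elim ((1 - a) * p s) fun t => if t = s then a * p s else 0, ?_, ?_, ?_⟩
  · rintro (_ | t) s
    · exact mul_nonneg (sub_nonneg.2 ha1) (hp s)
    · change 0 ≤ if t = s then a * p s else 0
      split_ifs
      · exact mul_nonneg ha0 (hp s)
      · exact le_rfl
  · intro s
    simp only [Fintype.sum_option, Option.elim_none, Option.elim_some, Finset.sum_ite_eq',
      Finset.mem_univ, if_true]
    ring
  · simp only [Fintype.sum_option, Option.elim_none, Option.elim_some, Finset.sum_ite_eq,
      Finset.mem_univ, if_true, apply_ite Real.negMulLog, Real.negMulLog_zero, hscale,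
      ← Finset.mul_sum, hsum, mul_one]
    linarith

/-- **first lower bound on utility in Theorem 1.** Let `S, Z, W` have joint
distribution `μ = P_{S,Z,W}` and `0 ≤ ε ≤ H(S)`.  Then there exists a random variable `U`
(on a probability space carrying a copy of `(S,Z,W)`), generated from `(S,Z)` (i.e. with
`I(U;W|S,Z) = 0`, the Markov chain `U — (S,Z) — W`), such that `I(U;S) = ε` and
`I(U;W) ≥ L¹(ε) := H(Z|S) − H(S|Z) + ε − H(Z|W)`. -/
theorem first_lower_bound_utility
    {σ ζ τ : Type} [Fintype σ] [MeasurableSpace σ] [MeasurableSingletonClass σ]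
    [Fintype ζ] [MeasurableSpace ζ] [MeasurableSingletonClass ζ]
    [Fintype τ] [MeasurableSpace τ] [MeasurableSingletonClass τ]
    (μ : Measure (σ × ζ × τ)) [IsProbabilityMeasure μ]
    {ε : ℝ} (hε : 0 ≤ ε) (hεH : ε ≤ infH μ (fun p => p.1)) :
    ∃ (Ω : Type) (_ : MeasurableSpace Ω) (P : Measure Ω) (_ : IsProbabilityMeasure P)
      (Sv : Ω → σ) (Zv : Ω → ζ) (Wv : Ω → τ) (n : ℕ) (U : Ω → Fin n),
      Measurable Sv ∧ Measurable Zv ∧ Measurable Wv ∧ Measurable U ∧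
      P.map (fun ω => (Sv ω, Zv ω, Wv ω)) = μ ∧
      infCMI P U Wv (fun ω => (Sv ω, Zv ω)) = 0 ∧
      infMI P U Sv = ε ∧
      infMI P U Wv ≥
        infCondH μ (fun p => p.2.1) (fun p => p.1)
          - infCondH μ (fun p => p.1) (fun p => p.2.1) + ε
          - infCondH μ (fun p => p.2.1) (fun p => p.2.2) := by
  classical
  have hne : Nonempty (σ × ζ × τ) := nonempty_of_isProbabilityMeasure μ
  have : Nonempty ζ := hne.map fun p => p.2.1
  have : Nonempty τ := hne.map fun p => p.2.2
  obtain ⟨k, hk0, hk1, hk⟩ := exists_conditional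
    (fun (q : σ × ζ) w => μ.real {(q.1, q.2, w)}) fun _ _ => measureReal_nonneg
  obtain ⟨c, hc0, hc1, hc⟩ := exists_conditional
    (fun s z => ∑ w, μ.real {(s, z, w)}) fun _ _ =>
      Finset.sum_nonneg fun _ _ => measureReal_nonneg
  set p : σ → ℝ := fun s => ∑ z, ∑ w, μ.real {(s, z, w)} with hp
  have hμ (s z w) : μ.real {(s, z, w)} = p s * c s z * k (s, z) w := by
    rw [hk (s, z) w, hc s z]
  have hp0 (s) : 0 ≤ p s :=
    Finset.sum_nonneg fun _ _ => Finset.sum_nonneg fun _ _ => measureReal_nonneg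
  have hp1 : ∑ s, p s = 1 := by
    have h := sum_measureReal_singleton (μ := μ) (Finset.univ)
    rw [Finset.coe_univ, probReal_univ, Fintype.sum_prod_type] at h
    simpa only [Fintype.sum_prod_type] using h
  have hpμ (s) : (μ ((fun q : σ × ζ × τ => q.1) ⁻¹' {s})).toReal = p s := by
    rw [measureReal_preimage_eq_sum]
    simp only [Fintype.sum_prod_type, hp]
    rw [Finset.sum_eq_single s] <;> simp +contextual
  have hHp : infH μ (fun q => q.1) = ∑ s, Real.negMulLog (p s) := by
    simp only [infH, hpμ]
  obtain ⟨m, hm0, hm1, hmε⟩ := exists_erasure p hp0 hp1 hε (hHp ▸ hεH)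
  set Q : (σ → ζ) → ℝ := fun v => ∏ t, c t (v t) with hQ
  have hQ1 : ∑ v, Q v = 1 := by
    have h := Finset.prod_univ_sum (fun _ : σ => (Finset.univ : Finset ζ)) c
    simpa [hc1, Fintype.piFinset_univ] using h.symm
  have hQc (s z) : ∑ v, (if v s = z then Q v else 0) = c s z := sum_prod_marginal c hc1 s z
  have hm_sum : ∑ j, ∑ s, m j s = 1 := by
    rw [Finset.sum_comm]
    simp only [hm1, hp1]
  let Ω := (σ → ζ) × Option σ × σ × τ
  let : MeasurableSpace Ω := ⊤
  have : MeasurableSingletonClass Ω := ⟨fun _ => trivial⟩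
  obtain ⟨P, hPprob, hP⟩ := exists_measure_of_weights
    (fun ω : Ω => Q ω.1 * m ω.2.1 ω.2.2.1 * k (ω.2.2.1, ω.1 ω.2.2.1) ω.2.2.2)
    (fun ω => mul_nonneg (mul_nonneg (Finset.prod_nonneg fun _ _ => hc0 _ _) (hm0 _ _))
      (hk0 _ _)) (by
        simp only [Ω, Fintype.sum_prod_type, ← Finset.mul_sum, hk1, mul_one, hm_sum, hQ1])
  let U : Ω → (σ → ζ) × Option σ := fun ω => (ω.1, ω.2.1)
  let S : Ω → σ := fun ω => ω.2.2.1
  let Z : Ω → ζ := fun ω => ω.1 ω.2.2.1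
  let W : Ω → τ := fun ω => ω.2.2.2
  have hmeas {β : Type} [MeasurableSpace β] (f : Ω → β) : Measurable f := fun _ _ => trivial
  have hmap : P.map (fun ω => (S ω, Z ω, W ω)) = μ := by
    have := Measure.isProbabilityMeasure_map (μ := P)
      (hmeas fun ω => (S ω, Z ω, W ω)).aemeasurable
    refine Measure.ext_of_singleton fun ⟨s, z, w⟩ => ?_
    rw [← measureReal_eq_measureReal_iff, hμ, Measure.real,
      Measure.map_apply (hmeas _) (MeasurableSet.singleton _), measureReal_preimage_eq_sum]
    simp only [hP, Ω, S, Z, W, Fintype.sum_prod_type, Prod.mk.injEq]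
    calc _ = ∑ v : σ → ζ, ∑ j, (if v s = z then Q v else 0) * m j s * k (s, z) w := by
          refine Finset.sum_congr rfl fun v _ => Finset.sum_congr rfl fun j _ => ?_
          rw [Finset.sum_eq_single s (by simp +contextual) (by simp),
            Finset.sum_eq_single w (by simp +contextual) (by simp)]
          by_cases h : v s = z <;> simp [h]
      _ = _ := by
          simp only [← Finset.sum_mul, ← Finset.mul_sum, hm1, hQc]
          ring
  have hUS (u s) : (P ((fun ω => (U ω, S ω)) ⁻¹' {(u, s)})).toReal = Q u.1 * m u.2 s := by
    obtain ⟨v, j⟩ := u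
    rw [measureReal_preimage_eq_sum]
    simp only [hP, Ω, U, S, Fintype.sum_prod_type, Prod.mk.injEq]
    rw [Finset.sum_eq_single v (by simp +contextual) (by simp),
      Finset.sum_eq_single j (by simp +contextual) (by simp),
      Finset.sum_eq_single s (by simp +contextual) (by simp)]
    simp [← Finset.mul_sum, hk1]
  have hU (u) : (P (U ⁻¹' {u})).toReal = Q u.1 * ∑ s, m u.2 s := by
    simp only [← sum_measureReal_preimage_prodMk P U S, hUS, Finset.mul_sum]
  have hMarkov : infCMI P U W (fun ω => (S ω, Z ω)) = 0 := by
    refine infCMI_eq_zero_of_factor P U W _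
      (fun u q => if u.1 q.1 = q.2 then Q u.1 * m u.2 q.1 else 0) k hk1 ?_
    rintro ⟨v, j⟩ w ⟨s, z⟩
    rw [measureReal_preimage_eq_sum]
    simp only [hP, Ω, U, S, Z, W, Fintype.sum_prod_type, Prod.mk.injEq]
    rw [Finset.sum_eq_single v (by simp +contextual) (by simp),
      Finset.sum_eq_single j (by simp +contextual) (by simp),
      Finset.sum_eq_single s (by simp +contextual) (by simp),
      Finset.sum_eq_single w (by simp +contextual) (by simp)]
    by_cases h : v s = z <;> simp [h]
  have hleak : infMI P U S = ε := by
    have e1 := infH_of_product P U Q (fun j => ∑ s, m j s) hQ1 hm_sum fun v j => hU (v, j)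
    have e2 := infH_of_product P (fun ω => (ω.1, (ω.2.1, S ω))) Q (fun q => m q.1 q.2) hQ1
      (by rw [Fintype.sum_prod_type]; exact hm_sum) (by
        rintro v ⟨j, s⟩
        rw [← hUS (v, j) s]
        congr 2
        ext ω
        simp [U, and_assoc])
    have e3 := infH_comp_equiv P (fun ω => (U ω, S ω)) (Equiv.prodAssoc _ _ _)
    have e4 : infH P S = ∑ s, Real.negMulLog (p s) := by
      rw [← hHp, ← hmap, infH_map P (hmeas _)]
    simp only [Equiv.prodAssoc_apply, U] at e3
    rw [Fintype.sum_prod_type] at e2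
    rw [infMI, e1, e4, ← e3, e2, ← hmε]
    ring
  let e := Fintype.equivFin ((σ → ζ) × Option σ)
  refine ⟨Ω, inferInstance, P, hPprob, S, Z, W, _, fun ω => e (U ω), hmeas _, hmeas _, hmeas _,
    hmeas _, hmap, ?_, ?_, ?_⟩
  · rw [infCMI_comp_equiv, hMarkov]
  · rw [infMI_comp_equiv, hleak]
  · rw [infMI_comp_equiv, ← hleak, ← hmap]
    simp only [infCondH, infH_map P (hmeas _)]
    exact infMI_lower_bound P U S Z W (fun u s => u.1 s) fun _ => rfl
end

section
/- Let S, Z, W be random variables on finite alphabets with joint distribution P_{S,Z,W}, where Z plays the role of the semantic f(X) and W the role of the task h(X), and let ε ≥ 0. If U* is any random variable generated from (S,Z) that attains the supremum h_ε(P_{S,Z}) = sup_{P_{U|S,Z}: I(U;S) ≤ ε} I(U;Z), then I(U*;W) ≥ L^3(ε) := h_ε(P_{S,Z}) − H(Z|W). (Third lower bound on utility in Theorem 1.) -/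
open MeasureTheory ProbabilityTheory

/-- The privacy–utility trade-off `h_ε(P_{S,Z})`: the supremum of `I(U;Z)` over all
random variables `U` (with finite alphabet), defined on some probability space carrying a
copy of `(S,Z)` with joint distribution `μ`, subject to the leakage constraint `I(U;S) ≤ ε`. -/
noncomputable def hEps {σ ζ : Type} [Fintype σ] [MeasurableSpace σ] [MeasurableSingletonClass σ]
    [Fintype ζ] [MeasurableSpace ζ] [MeasurableSingletonClass ζ]
    (μ : Measure (σ × ζ)) (ε : ℝ) : ℝ :=
  sSup { r : ℝ | ∃ (Ω : Type) (_ : MeasurableSpace Ω) (P : Measure Ω)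
    (_ : IsProbabilityMeasure P) (Sv : Ω → σ) (Zv : Ω → ζ) (n : ℕ) (U : Ω → Fin n),
    Measurable Sv ∧ Measurable Zv ∧ Measurable U ∧
    P.map (fun ω => (Sv ω, Zv ω)) = μ ∧
    infMI P U Sv ≤ ε ∧ r = infMI P U Zv }

/-- Strong subadditivity of the entropy functional for a nonnegative array on `α × β × γ`. -/
lemma sum_negMulLog_strong_subadditive {α β γ : Type*} [Fintype α] [Fintype β] [Fintype γ]
    (p : α → β → γ → ℝ) (hp : ∀ a b c, 0 ≤ p a b c) :
    (∑ a, ∑ b, ∑ c, Real.negMulLog (p a b c)) + ∑ b, Real.negMulLog (∑ a, ∑ c, p a b c) ≤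
      (∑ a, ∑ b, Real.negMulLog (∑ c, p a b c)) + ∑ b, ∑ c, Real.negMulLog (∑ a, p a b c) := by
  have hq0 a b : 0 ≤ ∑ c, p a b c := Finset.sum_nonneg fun c _ => hp a b c
  have hr0 b c : 0 ≤ ∑ a, p a b c := Finset.sum_nonneg fun a _ => hp a b c
  have hpq a b c : p a b c ≤ ∑ c, p a b c :=
    Finset.single_le_sum (f := fun c => p a b c) (fun c _ => hp a b c) (Finset.mem_univ c)
  have hpr a b c : p a b c ≤ ∑ a, p a b c :=
    Finset.single_le_sum (f := fun a => p a b c) (fun a _ => hp a b c) (Finset.mem_univ a)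
  have hqt a b : ∑ c, p a b c ≤ ∑ a, ∑ c, p a b c :=
    Finset.single_le_sum (f := fun a => ∑ c, p a b c) (fun a _ => hq0 a b) (Finset.mem_univ a)
  have pointwise a b c : p a b c - (∑ c, p a b c) * (∑ a, p a b c) / ∑ a, ∑ c, p a b c ≤
      p a b c * Real.log (p a b c) + p a b c * Real.log (∑ a, ∑ c, p a b c)
        - p a b c * Real.log (∑ c, p a b c) - p a b c * Real.log (∑ a, p a b c) := by
    have h1 := hpq a b c
    have h2 := hpr a b c
    have h3 := hqt a b
    have h4 := hr0 b c
    have h5 := hq0 a b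
    generalize (∑ c, p a b c) = q at *
    generalize (∑ a, p a b c) = r at *
    generalize (∑ a, ∑ c, p a b c) = t at *
    rcases (hp a b c).eq_or_lt with h | h
    · rw [← h]
      have : 0 ≤ q * r / t := div_nonneg (mul_nonneg h5 h4) (h5.trans h3)
      linarith
    · generalize p a b c = x at *
      have hq : 0 < q := by linarith
      have hr : 0 < r := by linarith
      have ht : 0 < t := by linarith
      have hlog := Real.log_le_sub_one_of_pos (x := q * r / (x * t)) (by positivity)
      rw [Real.log_div (by positivity) (by positivity), Real.log_mul hq.ne' hr.ne',
        Real.log_mul h.ne' ht.ne'] at hlog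
      have hmul := mul_le_mul_of_nonneg_left hlog h.le
      have : x * (q * r / (x * t) - 1) = q * r / t - x := by field_simp
      linarith
  have mass : ∑ a, ∑ b, ∑ c, (∑ c, p a b c) * (∑ a, p a b c) / (∑ a, ∑ c, p a b c) =
      ∑ a, ∑ b, ∑ c, p a b c := by
    rw [Finset.sum_comm, Finset.sum_comm (f := fun a b => ∑ c, p a b c)]
    refine Finset.sum_congr rfl fun b _ => ?_
    simp_rw [← Finset.sum_div, ← Finset.mul_sum]
    rw [← Finset.sum_mul, Finset.sum_comm (f := fun c a => p a b c),
      mul_self_div_self]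
  have total := Finset.sum_le_sum fun a (_ : a ∈ Finset.univ) =>
    Finset.sum_le_sum fun b (_ : b ∈ Finset.univ) =>
      Finset.sum_le_sum fun c (_ : c ∈ Finset.univ) => pointwise a b c
  simp only [Finset.sum_sub_distrib, Finset.sum_add_distrib, mass, sub_self] at total
  have e1 : ∑ b, Real.negMulLog (∑ a, ∑ c, p a b c) =
      -∑ a, ∑ b, ∑ c, p a b c * Real.log (∑ a, ∑ c, p a b c) := by
    rw [Finset.sum_comm]
    simp_rw [← Finset.sum_mul, Real.negMulLog, neg_mul, Finset.sum_neg_distrib]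
  have e2 : ∑ a, ∑ b, Real.negMulLog (∑ c, p a b c) =
      -∑ a, ∑ b, ∑ c, p a b c * Real.log (∑ c, p a b c) := by
    simp_rw [← Finset.sum_mul, Real.negMulLog, neg_mul, Finset.sum_neg_distrib]
  have e3 : ∑ b, ∑ c, Real.negMulLog (∑ a, p a b c) =
      -∑ a, ∑ b, ∑ c, p a b c * Real.log (∑ a, p a b c) := by
    rw [Finset.sum_comm (f := fun a b => ∑ c, p a b c * Real.log (∑ a, p a b c)),
      ← Finset.sum_neg_distrib]
    refine Finset.sum_congr rfl fun b _ => ?_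
    rw [Finset.sum_comm (f := fun a c => p a b c * Real.log (∑ a, p a b c))]
    simp_rw [← Finset.sum_mul, Real.negMulLog, neg_mul, Finset.sum_neg_distrib]
  have e4 : ∑ a, ∑ b, ∑ c, Real.negMulLog (p a b c) =
      -∑ a, ∑ b, ∑ c, p a b c * Real.log (p a b c) := by
    simp_rw [Real.negMulLog, neg_mul, Finset.sum_neg_distrib]
  rw [e1, e2, e3, e4]
  linarith

/-- The entropy functional does not increase when a nonnegative family is merged into its sum. -/
lemma negMulLog_sum_le_s13 {β : Type*} [Fintype β] (p : β → ℝ) (hp : ∀ b, 0 ≤ p b) :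
    Real.negMulLog (∑ b, p b) ≤ ∑ b, Real.negMulLog (p b) := by
  simp_rw [Real.negMulLog, neg_mul, Finset.sum_neg_distrib, Finset.sum_mul]
  refine neg_le_neg (Finset.sum_le_sum fun b _ => ?_)
  rcases (hp b).eq_or_lt with h | h
  · simp [← h]
  · exact mul_le_mul_of_nonneg_left (Real.log_le_log h
      (Finset.single_le_sum (fun c _ => hp c) (Finset.mem_univ b))) h.le

/-- The law of total probability over the values of a finite-valued random variable `Y`. -/
lemma measure_toReal_eq_sum_inter {Ω β : Type*} [MeasurableSpace Ω] [Fintype β]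
    [MeasurableSpace β] [MeasurableSingletonClass β] (P : Measure Ω) [IsFiniteMeasure P]
    {Y : Ω → β} (hY : Measurable Y) (A : Set Ω) :
    (P A).toReal = ∑ b, (P (A ∩ Y ⁻¹' {b})).toReal := by
  rw [← ENNReal.toReal_sum fun b _ => measure_ne_top P _]
  congr 1
  have h := sum_measure_preimage_singleton (μ := P.restrict A) (Finset.univ : Finset β) (f := Y)
    fun b _ => hY (measurableSet_singleton b)
  simp only [Finset.coe_univ, Set.preimage_univ, Measure.restrict_apply_univ] at h
  rw [← h]
  refine Finset.sum_congr rfl fun b _ => ?_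
  rw [Measure.restrict_apply (hY (measurableSet_singleton b)), Set.inter_comm]

/-- `H(X, Z) + H(Y) ≤ H(X, Y) + H(Y, Z)`. -/
lemma infH_pair_add_le {Ω α β γ : Type*} [MeasurableSpace Ω] (P : Measure Ω) [IsFiniteMeasure P]
    [Fintype α] [MeasurableSpace α] [MeasurableSingletonClass α]
    [Fintype β] [MeasurableSpace β] [MeasurableSingletonClass β]
    [Fintype γ] [MeasurableSpace γ] [MeasurableSingletonClass γ]
    {X : Ω → α} {Y : Ω → β} {Z : Ω → γ}
    (hX : Measurable X) (hY : Measurable Y) (hZ : Measurable Z) :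
    infH P (fun ω => (X ω, Z ω)) + infH P Y ≤
      infH P (fun ω => (X ω, Y ω)) + infH P (fun ω => (Y ω, Z ω)) := by
  let p a b c := (P (X ⁻¹' {a} ∩ Y ⁻¹' {b} ∩ Z ⁻¹' {c})).toReal
  have hp a b c : 0 ≤ p a b c := ENNReal.toReal_nonneg
  have hXY a b : (P (X ⁻¹' {a} ∩ Y ⁻¹' {b})).toReal = ∑ c, p a b c :=
    measure_toReal_eq_sum_inter P hZ _
  have hXZ a c : (P (X ⁻¹' {a} ∩ Z ⁻¹' {c})).toReal = ∑ b, p a b c := by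
    rw [measure_toReal_eq_sum_inter P hY]
    simp only [p, Set.inter_right_comm]
  have hYZ b c : (P (Y ⁻¹' {b} ∩ Z ⁻¹' {c})).toReal = ∑ a, p a b c := by
    rw [measure_toReal_eq_sum_inter P hX]
    refine Finset.sum_congr rfl fun a _ => ?_
    simp only [p]
    rw [Set.inter_comm, Set.inter_assoc]
  have hYm b : (P (Y ⁻¹' {b})).toReal = ∑ a, ∑ c, p a b c := by
    rw [measure_toReal_eq_sum_inter P hX]
    refine Finset.sum_congr rfl fun a _ => ?_
    rw [Set.inter_comm, hXY]
  have drop : ∑ a, ∑ c, Real.negMulLog (∑ b, p a b c) ≤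
      ∑ a, ∑ b, ∑ c, Real.negMulLog (p a b c) := by
    refine Finset.sum_le_sum fun a _ => ?_
    rw [Finset.sum_comm (f := fun b c => Real.negMulLog (p a b c))]
    exact Finset.sum_le_sum fun c _ => negMulLog_sum_le_s13 _ fun b => hp a b c
  have hsub := sum_negMulLog_strong_subadditive p hp
  simp only [infH, Fintype.sum_prod_type]
  have exz : ∑ a, ∑ c, Real.negMulLog (P ((fun ω => (X ω, Z ω)) ⁻¹' {(a, c)})).toReal =
      ∑ a, ∑ c, Real.negMulLog (∑ b, p a b c) := by
    simp_rw [← hXZ, Set.preimage, Set.mem_singleton_iff, Prod.mk.injEq]; rfl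
  have exy : ∑ a, ∑ b, Real.negMulLog (P ((fun ω => (X ω, Y ω)) ⁻¹' {(a, b)})).toReal =
      ∑ a, ∑ b, Real.negMulLog (∑ c, p a b c) := by
    simp_rw [← hXY, Set.preimage, Set.mem_singleton_iff, Prod.mk.injEq]; rfl
  have eyz : ∑ b, ∑ c, Real.negMulLog (P ((fun ω => (Y ω, Z ω)) ⁻¹' {(b, c)})).toReal =
      ∑ b, ∑ c, Real.negMulLog (∑ a, p a b c) := by
    simp_rw [← hYZ, Set.preimage, Set.mem_singleton_iff, Prod.mk.injEq]; rfl
  simp_rw [exz, exy, eyz, hYm]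
  linarith

/-- **third lower bound on utility in Theorem 1.** Let `S, Z, W` be random
variables on finite alphabets (with `Z` the semantic and `W` the task) and `ε ≥ 0`.  If `U*`
is generated from `(S,Z)` (Markov chain `U* — (S,Z) — W`, i.e. `I(U*;W|S,Z) = 0`), satisfies
the leakage constraint `I(U*;S) ≤ ε`, and attains the supremum `h_ε(P_{S,Z})`, i.e.
`I(U*;Z) = h_ε(P_{S,Z})`, then `I(U*;W) ≥ L³(ε) := h_ε(P_{S,Z}) − H(Z|W)`. -/
theorem third_lower_bound_utility
    {Ω : Type} [MeasurableSpace Ω] (P : Measure Ω) [IsProbabilityMeasure P]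
    {σ ζ τ υ : Type} [Fintype σ] [MeasurableSpace σ] [MeasurableSingletonClass σ]
    [Fintype ζ] [MeasurableSpace ζ] [MeasurableSingletonClass ζ]
    [Fintype τ] [MeasurableSpace τ] [MeasurableSingletonClass τ]
    [Fintype υ] [MeasurableSpace υ] [MeasurableSingletonClass υ]
    (S : Ω → σ) (Z : Ω → ζ) (W : Ω → τ) (Ustar : Ω → υ)
    (hS : Measurable S) (hZ : Measurable Z) (hW : Measurable W) (hU : Measurable Ustar)
    {ε : ℝ} (hε : 0 ≤ ε)
    (hMarkov : infCMI P Ustar W (fun ω => (S ω, Z ω)) = 0)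
    (hleak : infMI P Ustar S ≤ ε)
    (hopt : infMI P Ustar Z = hEps (P.map (fun ω => (S ω, Z ω))) ε) :
    infMI P Ustar W ≥ hEps (P.map (fun ω => (S ω, Z ω))) ε - infCondH P Z W := by
  rw [← hopt]
  have h := infH_pair_add_le P hU hZ hW
  unfold infMI infCondH
  linarith
end
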